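/- arXiv:1211.3251 — 2 statements merged into one kernel-verified Lean document; each statement's English description precedes it below -/
import Mathlib

section
/- Proposition 3, angle inequalities at a curvature minimum (vertex): Let γ be a unit-speed plane curve with signed curvature k, let s₁ < s₂ < s₃ < s₄ < s₅, set Pᵢ = γ(sᵢ) (pairwise distinct) and vᵢ = P_{i+1} − Pᵢ with cᵢ = ‖vᵢ‖/2 and v̂ᵢ = vᵢ/‖vᵢ‖. Assume k is nonincreasing on [s₁, s₃] and nondecreasing on [s₃, s₅] (vertex of minimal curvature at P₃), each of the four arcs is one-to-one projectable onto its chord (⟨γ'(s), v̂ᵢ⟩ > 0 for s ∈ [s_i, s_{i+1}], i = 1,…,4), and ‖v₁‖² + ⟨v₁, v₂⟩ ≥ 0 and ‖v₄‖² + ⟨v₃, v₄⟩ ≥ 0. Define α₂ = arcsin(det(v̂₂, γ'(s₂))), β₂ = arcsin(det(v̂₂, γ'(s₃))), α₃ = arcsin(det(v̂₃, γ'(s₃))), β₃ = arcsin(det(v̂₃, γ'(s₄))), ξ₂ = arcsin(−c₂·q(P₁, P₂, P₃)), η₃ = arcsin(c₃·q(P₃, P₄, P₅)), and let ρ₃ ∈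 (−π, π] be the signed angle from v̂₂ to v̂₃ (cos ρ₃ = ⟨v̂₂, v̂₃⟩, sin ρ₃ = det(v̂₂, v̂₃)). Then: (i) on the chord P₂P₃ ending at the vertex, ξ₂ ≤ α₂ ≤ −β₂ ≤ η₃ − ρ₃; and (ii) on the chord P₃P₄ starting at the vertex, −η₃ ≤ −β₃ ≤ α₃ ≤ −ξ₂ − ρ₃. -/
open scoped InnerProductSpace

/-- Planar cross product: `det((a₁,a₂),(b₁,b₂)) = a₁·b₂ − a₂·b₁`. -/
noncomputable def det2 (a b : EuclideanSpace ℝ (Fin 2)) : ℝ :=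
  a 0 * b 1 - a 1 * b 0

/-- Signed curvature of a unit-speed plane curve: `k(s) = det(γ'(s), γ''(s))`. -/
noncomputable def signedCurv (γ : ℝ → EuclideanSpace ℝ (Fin 2)) (s : ℝ) : ℝ :=
  det2 (deriv γ s) (deriv (deriv γ) s)

/-- Signed curvature of the directed circle through three pairwise distinct
points `A`, `B`, `C`. -/
noncomputable def q3 (A B C : EuclideanSpace ℝ (Fin 2)) : ℝ :=
  2 * det2 (B - A) (C - B) / (‖B - A‖ * ‖C - B‖ * ‖C - A‖)

/-- The data of an arc that is a graph over its chord: `x`, `y` are the coordinates of the curve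
along and across the chord, `C`, `w` the cosine and sine of the tangent angle and `k` the
curvature. -/
structure GraphArc (x y w C k : ℝ → ℝ) (a b : ℝ) : Prop where
  lt : a < b
  hasDerivAt_x : ∀ s, HasDerivAt x (C s) s
  hasDerivAt_y : ∀ s, HasDerivAt y (w s) s
  hasDerivAt_w : ∀ s, HasDerivAt w (k s * C s) s
  sq_add_sq : ∀ s, C s ^ 2 + w s ^ 2 = 1
  cos_pos : ∀ s ∈ Set.Icc a b, 0 < C s
  x_left : x a = 0
  y_eq : y a = y b

namespace GraphArc

variable {x y w C k : ℝ → ℝ} {a b : ℝ}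

/-- Reflection of an arc across its chord. -/
theorem neg (h : GraphArc x y w C k a b) :
    GraphArc x (fun s => -y s) (fun s => -w s) C (fun s => -k s) a b where
  lt := h.lt
  hasDerivAt_x := h.hasDerivAt_x
  hasDerivAt_y s := (h.hasDerivAt_y s).neg
  hasDerivAt_w s := (h.hasDerivAt_w s).neg.congr_deriv (neg_mul _ _).symm
  sq_add_sq s := by simpa using h.sq_add_sq s
  cos_pos := h.cos_pos
  x_left := h.x_left
  y_eq := by simp [h.y_eq]

theorem abs_w_lt_one (h : GraphArc x y w C k a b) {s : ℝ} (hs : s ∈ Set.Icc a b) :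
    -1 < w s ∧ w s < 1 := by
  have h1 := h.sq_add_sq s
  have h2 := h.cos_pos s hs
  constructor <;> nlinarith

theorem monotoneOn_of_deriv_nonneg {f f' : ℝ → ℝ} (hf : ∀ s ∈ Set.Icc a b, HasDerivAt f (f' s) s)
    (hf' : ∀ s ∈ Set.Icc a b, 0 ≤ f' s) : MonotoneOn f (Set.Icc a b) := by
  apply _root_.monotoneOn_of_deriv_nonneg (convex_Icc a b)
    (fun s hs => (hf s hs).continuousAt.continuousWithinAt)
  · exact fun s hs => (hf s (interior_subset hs)).differentiableAt.differentiableWithinAt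
  · intro s hs
    rw [(hf s (interior_subset hs)).deriv]
    exact hf' s (interior_subset hs)

theorem monotoneOn_x (h : GraphArc x y w C k a b) : MonotoneOn x (Set.Icc a b) :=
  monotoneOn_of_deriv_nonneg (fun s _ => h.hasDerivAt_x s) fun s hs => (h.cos_pos s hs).le

theorem strictMonoOn_x (h : GraphArc x y w C k a b) : StrictMonoOn x (Set.Icc a b) := by
  apply strictMonoOn_of_deriv_pos (convex_Icc a b)
    (fun s _ => (h.hasDerivAt_x s).continuousAt.continuousWithinAt)
  intro s hs
  rw [(h.hasDerivAt_x s).deriv]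
  exact h.cos_pos s (interior_subset hs)

theorem x_right_pos (h : GraphArc x y w C k a b) : 0 < x b := by
  rw [← h.x_left]
  exact h.strictMonoOn_x (Set.left_mem_Icc.2 h.lt.le) (Set.right_mem_Icc.2 h.lt.le) h.lt

/-- The slope `t / √(1 - t²)` is monotone in the sine `t` of the tangent angle. -/
theorem w_le_slope_mul (h : GraphArc x y w C k a b) {s t : ℝ} (hs : s ∈ Set.Icc a b)
    (hwt : w s ≤ t) (ht : t < 1) : w s ≤ t * C s / √(1 - t ^ 2) := by
  obtain ⟨hw, hw1⟩ := h.abs_w_lt_one hs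
  have hC := h.cos_pos s hs
  have hCeq : C s = √(1 - w s ^ 2) := by
    rw [← h.sq_add_sq s, add_sub_cancel_right, Real.sqrt_sq hC.le]
  have hmono : Real.tan (Real.arcsin (w s)) ≤ Real.tan (Real.arcsin t) := by
    apply Real.strictMonoOn_tan.monotoneOn
    · exact ⟨Real.neg_pi_div_two_lt_arcsin.2 hw, Real.arcsin_lt_pi_div_two.2 hw1⟩
    · exact ⟨Real.neg_pi_div_two_lt_arcsin.2 (hw.trans_le hwt), Real.arcsin_lt_pi_div_two.2 ht⟩
    · exact Real.monotone_arcsin hwt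
  rw [Real.tan_arcsin, Real.tan_arcsin, ← hCeq, div_le_iff₀ hC] at hmono
  calc w s ≤ t / √(1 - t ^ 2) * C s := hmono
    _ = t * C s / √(1 - t ^ 2) := by ring

/-- If the sine of the tangent angle is bounded above by an affine function along the chord,
then that function has nonnegative mean. -/
theorem nonneg_of_le_affine (h : GraphArc x y w C k a b) {p m : ℝ}
    (hle : ∀ s ∈ Set.Icc a b, w s ≤ p + m * x s) : 0 ≤ 2 * p + m * x b := by
  have ha : a ∈ Set.Icc a b := Set.left_mem_Icc.2 h.lt.le
  have hb : b ∈ Set.Icc a b := Set.right_mem_Icc.2 h.lt.le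
  have hL := h.x_right_pos
  have hp : -1 < p := by simpa [h.x_left] using (h.abs_w_lt_one ha).1.trans_le (hle a ha)
  have hq : -1 < p + m * x b := (h.abs_w_lt_one hb).1.trans_le (hle b hb)
  by_contra! hneg
  have hp1 : p < 1 := by linarith
  have hq1 : p + m * x b < 1 := by linarith
  have hlt : ∀ s ∈ Set.Icc a b, -1 < p + m * x s ∧ p + m * x s < 1 := by
    intro s hs
    have h0 : 0 ≤ x s := h.x_left ▸ h.monotoneOn_x ha hs hs.1
    have h1 : x s ≤ x b := h.monotoneOn_x hs hb hs.2
    rcases le_total 0 m with hm | hm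
    · have := mul_le_mul_of_nonneg_left h1 hm
      have := mul_nonneg hm h0
      constructor <;> linarith
    · have := mul_le_mul_of_nonpos_left h1 hm
      have := mul_nonpos_of_nonpos_of_nonneg hm h0
      constructor <;> linarith
  rcases eq_or_ne m 0 with rfl | hm
  · have hmono : MonotoneOn (fun s => p * s - y s) (Set.Icc a b) :=
      monotoneOn_of_deriv_nonneg
        (fun s _ => ((hasDerivAt_id' s).const_mul p).sub (h.hasDerivAt_y s))
        fun s hs => by have := hle s hs; linarith
    have := hmono ha hb h.lt.le
    have := h.y_eq
    have := h.lt
    simp only [zero_mul, add_zero] at *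
    nlinarith
  · have hpos : ∀ s ∈ Set.Icc a b, 0 < 1 - (p + m * x s) ^ 2 := by
      intro s hs
      have := hlt s hs
      nlinarith
    have hmono : MonotoneOn (fun s => -(√(1 - (p + m * x s) ^ 2) / m) - y s) (Set.Icc a b) := by
      apply monotoneOn_of_deriv_nonneg
        (f' := fun s => (p + m * x s) * C s / √(1 - (p + m * x s) ^ 2) - w s)
      · intro s hs
        have h1 := ((((h.hasDerivAt_x s).const_mul m).const_add p).pow 2).const_sub 1
        have h2 := (((h1.sqrt (hpos s hs).ne').div_const m).neg).sub (h.hasDerivAt_y s)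
        refine h2.congr_deriv ?_
        have := (Real.sqrt_pos.2 (hpos s hs)).ne'
        simp only [Pi.pow_apply]
        field_simp
        ring
      · intro s hs
        have := h.w_le_slope_mul hs (hle s hs) (hlt s hs).2
        linarith
    have hab := hmono ha hb h.lt.le
    simp only [h.y_eq, h.x_left, mul_zero, add_zero] at hab
    have hdiv : √(1 - (p + m * x b) ^ 2) / m ≤ √(1 - p ^ 2) / m := by linarith
    have hb0 := (hpos b hb).le
    have ha0 : 0 ≤ 1 - p ^ 2 := by nlinarith
    rcases hm.lt_or_gt with hm | hm
    · rw [div_le_div_right_of_neg hm, Real.sqrt_le_sqrt_iff hb0] at hdiv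
      have := mul_neg_of_neg_of_pos hm hL
      nlinarith
    · rw [div_le_div_iff_of_pos_right hm, Real.sqrt_le_sqrt_iff ha0] at hdiv
      have := mul_pos hm hL
      nlinarith

theorem left_add_curvature_nonneg (h : GraphArc x y w C k a b)
    (hk : AntitoneOn k (Set.Icc a b)) : 0 ≤ 2 * w a + k a * x b := by
  have ha : a ∈ Set.Icc a b := Set.left_mem_Icc.2 h.lt.le
  apply h.nonneg_of_le_affine
  have hmono : MonotoneOn (fun s => k a * x s - w s) (Set.Icc a b) :=
    monotoneOn_of_deriv_nonneg
      (fun s _ => ((h.hasDerivAt_x s).const_mul (k a)).sub (h.hasDerivAt_w s))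
      fun s hs => sub_nonneg.2 <|
        mul_le_mul_of_nonneg_right (hk ha hs hs.1) (h.cos_pos s hs).le
  intro s hs
  have := hmono ha hs hs.1
  simp only [h.x_left] at this
  linarith

theorem right_sub_curvature_nonneg (h : GraphArc x y w C k a b)
    (hk : AntitoneOn k (Set.Icc a b)) : 0 ≤ 2 * w b - k b * x b := by
  have hb : b ∈ Set.Icc a b := Set.right_mem_Icc.2 h.lt.le
  have hmono : MonotoneOn (fun s => w s - k b * x s) (Set.Icc a b) :=
    monotoneOn_of_deriv_nonneg
      (fun s _ => (h.hasDerivAt_w s).sub ((h.hasDerivAt_x s).const_mul (k b)))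
      fun s hs => sub_nonneg.2 <|
        mul_le_mul_of_nonneg_right (hk hs hb hs.2) (h.cos_pos s hs).le
  have := h.nonneg_of_le_affine (p := w b - k b * x b) (m := k b) fun s hs => by
    have := hmono hs hb hs.2
    simp only at this
    linarith
  linarith

theorem left_add_right_nonpos (h : GraphArc x y w C k a b)
    (hk : AntitoneOn k (Set.Icc a b)) : w a + w b ≤ 0 := by
  have ha : a ∈ Set.Icc a b := Set.left_mem_Icc.2 h.lt.le
  have hb : b ∈ Set.Icc a b := Set.right_mem_Icc.2 h.lt.le
  have hL := h.x_right_pos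
  -- Cauchy's mean value theorem on a subinterval
  have hmv : ∀ {c d : ℝ}, a ≤ c → c < d → d ≤ b →
      ∃ σ ∈ Set.Ioo c d, w d - w c = k σ * (x d - x c) := by
    intro c d hac hcd hdb
    obtain ⟨σ, hσ, heq⟩ := exists_ratio_hasDerivAt_eq_ratio_slope x C hcd
      (fun s _ => (h.hasDerivAt_x s).continuousAt.continuousWithinAt)
      (fun s _ => h.hasDerivAt_x s) w (fun s => k s * C s)
      (fun s _ => (h.hasDerivAt_w s).continuousAt.continuousWithinAt)
      (fun s _ => h.hasDerivAt_w s)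
    have hC := h.cos_pos σ ⟨hac.trans hσ.1.le, hσ.2.le.trans hdb⟩
    refine ⟨σ, hσ, mul_right_cancel₀ hC.ne' ?_⟩
    linarith
  have := h.neg.nonneg_of_le_affine (p := -w a) (m := -((w b - w a) / x b)) fun s hs => by
    suffices hs' : (w b - w a) * x s ≤ (w s - w a) * x b by
      have : (w b - w a) / x b * x s ≤ w s - w a := by
        rw [div_mul_eq_mul_div, div_le_iff₀ hL]
        exact hs'
      linarith
    rcases hs.1.eq_or_lt with rfl | has
    · simp [h.x_left]
    rcases hs.2.eq_or_lt with rfl | hsb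
    · rfl
    obtain ⟨σ, hσ, hσe⟩ := hmv le_rfl has hs.2
    obtain ⟨τ, hτ, hτe⟩ := hmv hs.1 hsb le_rfl
    have hkστ : k τ ≤ k σ :=
      hk ⟨hσ.1.le, hσ.2.le.trans hs.2⟩ ⟨hs.1.trans hτ.1.le, hτ.2.le⟩ (hσ.2.trans hτ.1).le
    have h0 : 0 ≤ x s := h.x_left ▸ h.monotoneOn_x ha hs hs.1
    have h1 : x s ≤ x b := h.monotoneOn_x hs hb hs.2
    rw [h.x_left, sub_zero] at hσe
    have hprod := mul_le_mul_of_nonneg_right hkστ (mul_nonneg h0 (sub_nonneg.2 h1))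
    have e1 : w b - w a = k σ * x s + k τ * (x b - x s) := by linarith
    rw [e1, hσe]
    nlinarith
  have hmul : (w b - w a) / x b * x b = w b - w a := div_mul_cancel₀ _ hL.ne'
  linarith

end GraphArc

theorem det2_smul_left (r : ℝ) (a b : EuclideanSpace ℝ (Fin 2)) :
    det2 (r • a) b = r * det2 a b := by
  simp only [det2, PiLp.smul_apply, smul_eq_mul]
  ring

theorem inner_eq_coord (a b : EuclideanSpace ℝ (Fin 2)) : ⟪a, b⟫_ℝ = a 0 * b 0 + a 1 * b 1 := by
  simp only [PiLp.inner_apply, Fin.sum_univ_two, RCLike.inner_apply, conj_trivial]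
  ring

theorem norm_sq_eq_coord (a : EuclideanSpace ℝ (Fin 2)) : ‖a‖ ^ 2 = a 0 ^ 2 + a 1 ^ 2 := by
  rw [← real_inner_self_eq_norm_sq, inner_eq_coord]
  ring

/-- An arc of a unit-speed plane curve which is one-to-one projectable onto its chord. -/
theorem graphArc_of_projectable {γ : ℝ → EuclideanSpace ℝ (Fin 2)} (hγ : ContDiff ℝ 2 γ)
    (hunit : ∀ s, ‖deriv γ s‖ = 1) {a b : ℝ} (hab : a < b) {v e : EuclideanSpace ℝ (Fin 2)}
    (hv : v = γ b - γ a) (hv0 : v ≠ 0) (he : e = ‖v‖⁻¹ • v)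
    (hproj : ∀ s ∈ Set.Icc a b, 0 < ⟪deriv γ s, e⟫_ℝ) :
    GraphArc (fun s => ⟪γ s - γ a, e⟫_ℝ) (fun s => det2 e (γ s - γ a))
      (fun s => det2 e (deriv γ s)) (fun s => ⟪deriv γ s, e⟫_ℝ) (signedCurv γ) a b := by
  have hd : ∀ s, HasDerivAt γ (deriv γ s) s := fun s =>
    (hγ.differentiable (by norm_num) s).hasDerivAt
  have hγ' : ContDiff ℝ 1 (deriv γ) := by
    have : ContDiff ℝ (1 + 1) γ := by simpa [one_add_one_eq_two] using hγ
    exact (contDiff_succ_iff_deriv.1 this).2.2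
  have hdd : ∀ s, HasDerivAt (deriv γ) (deriv (deriv γ) s) s := fun s =>
    (hγ'.differentiable (by norm_num) s).hasDerivAt
  have hcoord : ∀ (f : ℝ → EuclideanSpace ℝ (Fin 2)) (f' : EuclideanSpace ℝ (Fin 2)) (s : ℝ),
      HasDerivAt f f' s → ∀ i, HasDerivAt (fun t => f t i) (f' i) s := fun f f' s hf i =>
    (EuclideanSpace.proj (𝕜 := ℝ) i).hasFDerivAt.comp_hasDerivAt s hf
  have hT : ∀ s, deriv γ s 0 ^ 2 + deriv γ s 1 ^ 2 = 1 := fun s => by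
    rw [← norm_sq_eq_coord, hunit, one_pow]
  have horth : ∀ s, deriv γ s 0 * deriv (deriv γ) s 0 + deriv γ s 1 * deriv (deriv γ) s 1 = 0 := by
    intro s
    have h1 := ((hcoord _ _ s (hdd s) 0).pow 2).add ((hcoord _ _ s (hdd s) 1).pow 2)
    have h2 : HasDerivAt (fun _ : ℝ => (1 : ℝ)) 0 s := hasDerivAt_const s 1
    have h3 := h1.unique (h2.congr_of_eventuallyEq (Filter.Eventually.of_forall hT))
    norm_num at h3
    linarith
  have hnv : ‖v‖ ≠ 0 := norm_ne_zero_iff.2 hv0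
  have hen : e 0 ^ 2 + e 1 ^ 2 = 1 := by
    rw [← norm_sq_eq_coord, he, norm_smul, norm_inv, norm_norm, inv_mul_cancel₀ hnv, one_pow]
  refine ⟨hab, fun s => ?_, fun s => ?_, fun s => ?_, fun s => ?_, hproj, by simp, ?_⟩
  · simp only [inner_eq_coord, PiLp.sub_apply]
    exact (((hcoord _ _ s (hd s) 0).sub_const _).mul_const _).add
      (((hcoord _ _ s (hd s) 1).sub_const _).mul_const _)
  · simp only [det2, PiLp.sub_apply]
    exact (((hcoord _ _ s (hd s) 1).sub_const _).const_mul _).sub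
      (((hcoord _ _ s (hd s) 0).sub_const _).const_mul _)
  · simp only [det2, signedCurv, inner_eq_coord]
    refine (((hcoord _ _ s (hdd s) 1).const_mul _).sub
      ((hcoord _ _ s (hdd s) 0).const_mul _)).congr_deriv ?_
    have h0 := horth s
    have h1 := hT s
    linear_combination (-(e 0 * deriv (deriv γ) s 1) + e 1 * deriv (deriv γ) s 0) * h1
      + (e 0 * deriv γ s 1 - e 1 * deriv γ s 0) * h0
  · simp only [det2, inner_eq_coord]
    linear_combination (deriv γ s 0 ^ 2 + deriv γ s 1 ^ 2) * hen + hT s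
  · rw [← hv, he, det2_smul_left]
    simp only [det2, sub_self, PiLp.zero_apply, PiLp.smul_apply, smul_eq_mul]
    ring

theorem inner_normalize_self {v : EuclideanSpace ℝ (Fin 2)} (hv : v ≠ 0) :
    ⟪v, ‖v‖⁻¹ • v⟫_ℝ = ‖v‖ := by
  have : ‖v‖ ≠ 0 := norm_ne_zero_iff.2 hv
  rw [real_inner_smul_right, real_inner_self_eq_norm_sq]
  field_simp

/-- Comparison of the circle through `-(a, b)`, `0`, `(c, d)` with the circle tangent to the
first axis at `0` that passes through `(c, d)`. -/
theorem tangent_circle_le_circle {a b c d U V W : ℝ} (ha : 0 < a) (hc : 0 < c) (hU : 0 < U)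
    (hV : 0 < V) (hW : 0 < W) (hU2 : U ^ 2 = a ^ 2 + b ^ 2) (hV2 : V ^ 2 = c ^ 2 + d ^ 2)
    (hW2 : W ^ 2 = (a + c) ^ 2 + (b + d) ^ 2) (hbd : d * U ^ 2 + b * V ^ 2 ≤ 0)
    (hturn : 0 ≤ U ^ 2 + (a * c + b * d)) :
    d / V ≤ (a * d - b * c) / (U * W) := by
  rw [div_le_div_iff₀ hV (mul_pos hU hW)]
  set X := a * V ^ 2 + c * U ^ 2 with hX
  set Y := b * V ^ 2 + d * U ^ 2 with hY
  have hXpos : 0 < X := by positivity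
  have hYneg : Y ≤ 0 := by linarith
  have hR2 : (U * V * W) ^ 2 = X ^ 2 + Y ^ 2 := by
    rw [mul_pow, mul_pow, hX, hY, hW2, hU2, hV2]
    ring
  have hRpos : 0 < U * V * W := by positivity
  have hXR : X ≤ U * V * W := by nlinarith [sq_nonneg Y]
  have hfoot : 0 ≤ c * X + d * Y := by
    have : c * X + d * Y = V ^ 2 * (U ^ 2 + (a * c + b * d)) := by rw [hX, hY, hV2]; ring
    rw [this]
    positivity
  have key : d * (U * V * W - X) ≤ c * -Y := by
    rcases le_or_gt d 0 with hd | hd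
    · exact (mul_nonpos_of_nonpos_of_nonneg hd (by linarith)).trans
        (mul_nonneg hc.le (by linarith))
    · refine le_of_mul_le_mul_right ?_ (add_pos hRpos hXpos)
      have e1 : d * (U * V * W - X) * (U * V * W + X) = d * Y ^ 2 := by
        linear_combination d * hR2
      have e2 := mul_nonneg hfoot (neg_nonneg.2 hYneg)
      have e3 := mul_nonneg (mul_nonneg hc.le (neg_nonneg.2 hYneg)) hRpos.le
      rw [e1]
      nlinarith
  have e4 : V * (V * (a * d - b * c)) = d * X - c * Y := by rw [hX, hY]; ring
  refine le_of_mul_le_mul_left ?_ hV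
  nlinarith

/-- Vector form of `tangent_circle_le_circle`: `T` is the unit tangent at the common endpoint of
consecutive chords `u`, `v`. -/
theorem neg_det2_div_le_sin {T u v : EuclideanSpace ℝ (Fin 2)} (hT : ‖T‖ = 1)
    (hu : 0 < ⟪T, ‖u‖⁻¹ • u⟫_ℝ) (hv : 0 < ⟪T, ‖v‖⁻¹ • v⟫_ℝ) (ε : ℝ) (hε : ε ^ 2 = 1)
    (hdet : 0 ≤ ε * (det2 (‖u‖⁻¹ • u) T * ‖v‖ + det2 (‖v‖⁻¹ • v) T * ‖u‖))
    (hturn : 0 ≤ ‖u‖ ^ 2 + ⟪u, v⟫_ℝ) (hw : u + v ≠ 0) :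
    -(ε * det2 (‖v‖⁻¹ • v) T) ≤ ε * det2 u v / (‖u‖ * ‖u + v‖) := by
  have hu0 : 0 < ‖u‖ := norm_pos_iff.2 (by rintro rfl; simp at hu)
  have hv0 : 0 < ‖v‖ := norm_pos_iff.2 (by rintro rfl; simp at hv)
  have hT2 : T 0 ^ 2 + T 1 ^ 2 = 1 := by rw [← norm_sq_eq_coord, hT, one_pow]
  rw [real_inner_smul_right] at hu hv
  rw [det2_smul_left, det2_smul_left] at hdet
  have hframe : ∀ z : EuclideanSpace ℝ (Fin 2), ‖z‖ ^ 2 = ⟪T, z⟫_ℝ ^ 2 + (-(ε * det2 z T)) ^ 2 := by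
    intro z
    rw [norm_sq_eq_coord, inner_eq_coord, det2]
    linear_combination (-(z 0 ^ 2 + z 1 ^ 2)) * hT2 - (z 0 * T 1 - z 1 * T 0) ^ 2 * hε
  have := tangent_circle_le_circle (a := ⟪T, u⟫_ℝ) (b := -(ε * det2 u T)) (c := ⟪T, v⟫_ℝ)
    (d := -(ε * det2 v T)) (pos_of_mul_pos_right hu (inv_nonneg.2 hu0.le))
    (pos_of_mul_pos_right hv (inv_nonneg.2 hv0.le)) hu0 hv0 (norm_pos_iff.2 hw)
    (hframe u) (hframe v)
    (by
      rw [hframe (u + v), inner_add_right]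
      simp only [det2, PiLp.add_apply]
      ring)
    (by
      have e1 : ε * (‖u‖⁻¹ * det2 u T * ‖v‖ + ‖v‖⁻¹ * det2 v T * ‖u‖) * (‖u‖ * ‖v‖)
          = ε * (det2 u T * ‖v‖ ^ 2 + det2 v T * ‖u‖ ^ 2) := by
        field_simp
      have e2 := mul_nonneg hdet (mul_pos hu0 hv0).le
      rw [e1] at e2
      linarith)
    (by
      convert hturn using 2
      simp only [inner_eq_coord, det2]
      linear_combination (u 0 * v 0 + u 1 * v 1) * hT2
        + (u 0 * T 1 - u 1 * T 0) * (v 0 * T 1 - v 1 * T 0) * hε)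
  calc -(ε * det2 (‖v‖⁻¹ • v) T) = -(ε * det2 v T) / ‖v‖ := by
        rw [det2_smul_left, div_eq_mul_inv]
        ring
    _ ≤ _ := this
    _ = _ := by
        congr 1
        simp only [inner_eq_coord, det2]
        linear_combination ε * (u 0 * v 1 - u 1 * v 0) * hT2

/-- The signed angle between unit vectors `e`, `f` is the difference of the angles that a unit
vector `T` with positive projections makes with them. -/
theorem angle_eq_arcsin_sub_arcsin {e f T : EuclideanSpace ℝ (Fin 2)} (hT : ‖T‖ = 1)
    (he : ‖e‖ = 1) (hf : ‖f‖ = 1) (heT : 0 < ⟪T, e⟫_ℝ) (hfT : 0 < ⟪T, f⟫_ℝ) {ρ : ℝ}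
    (hρ : ρ ∈ Set.Ioc (-Real.pi) Real.pi) (hcos : Real.cos ρ = ⟪e, f⟫_ℝ)
    (hsin : Real.sin ρ = det2 e f) :
    ρ = Real.arcsin (det2 e T) - Real.arcsin (det2 f T) := by
  have hT2 : T 0 ^ 2 + T 1 ^ 2 = 1 := by rw [← norm_sq_eq_coord, hT, one_pow]
  have hlag : ∀ z : EuclideanSpace ℝ (Fin 2), ‖z‖ = 1 → ⟪T, z⟫_ℝ ^ 2 + det2 z T ^ 2 = 1 := by
    intro z hz
    have hz2 : z 0 ^ 2 + z 1 ^ 2 = 1 := by rw [← norm_sq_eq_coord, hz, one_pow]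
    rw [inner_eq_coord, det2]
    linear_combination (z 0 ^ 2 + z 1 ^ 2) * hT2 + hz2
  have harc : ∀ z : EuclideanSpace ℝ (Fin 2), ‖z‖ = 1 → 0 < ⟪T, z⟫_ℝ →
      Real.sin (Real.arcsin (det2 z T)) = det2 z T ∧
      Real.cos (Real.arcsin (det2 z T)) = ⟪T, z⟫_ℝ ∧
      -(Real.pi / 2) < Real.arcsin (det2 z T) ∧ Real.arcsin (det2 z T) < Real.pi / 2 := by
    intro z hz hzT
    have h := hlag z hz
    have h1 : -1 < det2 z T := by nlinarith
    have h2 : det2 z T < 1 := by nlinarith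
    refine ⟨Real.sin_arcsin h1.le h2.le, ?_, Real.neg_pi_div_two_lt_arcsin.2 h1,
      Real.arcsin_lt_pi_div_two.2 h2⟩
    rw [Real.cos_arcsin, ← h, add_sub_cancel_right, Real.sqrt_sq hzT.le]
  obtain ⟨se, ce, le, ue⟩ := harc e he heT
  obtain ⟨sf, cf, lf, uf⟩ := harc f hf hfT
  set φ := Real.arcsin (det2 e T)
  set ψ := Real.arcsin (det2 f T)
  have hc : Real.cos (ρ - (φ - ψ)) = 1 := by
    rw [Real.cos_sub, Real.cos_sub, Real.sin_sub, se, ce, sf, cf, hcos, hsin]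
    have he2 := hlag e he
    have hf2 := hlag f hf
    have i1 : ⟪e, f⟫_ℝ = ⟪T, e⟫_ℝ * ⟪T, f⟫_ℝ + det2 e T * det2 f T := by
      simp only [inner_eq_coord, det2]
      linear_combination (-(e 0 * f 0 + e 1 * f 1)) * hT2
    have i2 : det2 e f = det2 e T * ⟪T, f⟫_ℝ - ⟪T, e⟫_ℝ * det2 f T := by
      simp only [inner_eq_coord, det2]
      linear_combination (-(e 0 * f 1 - e 1 * f 0)) * hT2
    rw [i1, i2]
    linear_combination (⟪T, f⟫_ℝ ^ 2 + det2 f T ^ 2) * he2 + hf2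
  have := (Real.cos_eq_one_iff_of_lt_of_lt (by linarith [hρ.1]) (by linarith [hρ.2])).1 hc
  linarith


/-- Proposition 3, angle inequalities at a vertex of minimal curvature `P₃`:
`ξ₂ ≤ α₂ ≤ −β₂ ≤ η₃ − ρ₃` on the chord `P₂P₃`, and
`−η₃ ≤ −β₃ ≤ α₃ ≤ −ξ₂ − ρ₃` on the chord `P₃P₄`. -/
theorem prop3_angle_inequalities_at_vertex
    (γ : ℝ → EuclideanSpace ℝ (Fin 2)) (hγ : ContDiff ℝ 2 γ)
    (hunit : ∀ s, ‖deriv γ s‖ = 1)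
    (s₁ s₂ s₃ s₄ s₅ : ℝ) (h12 : s₁ < s₂) (h23 : s₂ < s₃) (h34 : s₃ < s₄) (h45 : s₄ < s₅)
    (hanti : AntitoneOn (signedCurv γ) (Set.Icc s₁ s₃))
    (hmono : MonotoneOn (signedCurv γ) (Set.Icc s₃ s₅))
    (P₁ P₂ P₃ P₄ P₅ : EuclideanSpace ℝ (Fin 2))
    (hP₁ : P₁ = γ s₁) (hP₂ : P₂ = γ s₂) (hP₃ : P₃ = γ s₃) (hP₄ : P₄ = γ s₄)
    (hP₅ : P₅ = γ s₅)
    (hdist : ([P₁, P₂, P₃, P₄, P₅] : List (EuclideanSpace ℝ (Fin 2))).Pairwise (· ≠ ·))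
    (v₁ v₂ v₃ v₄ : EuclideanSpace ℝ (Fin 2))
    (hv₁ : v₁ = P₂ - P₁) (hv₂ : v₂ = P₃ - P₂) (hv₃ : v₃ = P₄ - P₃) (hv₄ : v₄ = P₅ - P₄)
    (c₂ c₃ : ℝ) (hc₂ : c₂ = ‖v₂‖ / 2) (hc₃ : c₃ = ‖v₃‖ / 2)
    (vhat₂ vhat₃ : EuclideanSpace ℝ (Fin 2))
    (hvhat₂ : vhat₂ = ‖v₂‖⁻¹ • v₂) (hvhat₃ : vhat₃ = ‖v₃‖⁻¹ • v₃)
    (hproj₁ : ∀ s ∈ Set.Icc s₁ s₂, 0 < ⟪deriv γ s, ‖v₁‖⁻¹ • v₁⟫_ℝ)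
    (hproj₂ : ∀ s ∈ Set.Icc s₂ s₃, 0 < ⟪deriv γ s, vhat₂⟫_ℝ)
    (hproj₃ : ∀ s ∈ Set.Icc s₃ s₄, 0 < ⟪deriv γ s, vhat₃⟫_ℝ)
    (hproj₄ : ∀ s ∈ Set.Icc s₄ s₅, 0 < ⟪deriv γ s, ‖v₄‖⁻¹ • v₄⟫_ℝ)
    (hturn₁ : 0 ≤ ‖v₁‖ ^ 2 + ⟪v₁, v₂⟫_ℝ)
    (hturn₂ : 0 ≤ ‖v₄‖ ^ 2 + ⟪v₃, v₄⟫_ℝ)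
    (α₂ β₂ α₃ β₃ ξ₂ η₃ : ℝ)
    (hα₂ : α₂ = Real.arcsin (det2 vhat₂ (deriv γ s₂)))
    (hβ₂ : β₂ = Real.arcsin (det2 vhat₂ (deriv γ s₃)))
    (hα₃ : α₃ = Real.arcsin (det2 vhat₃ (deriv γ s₃)))
    (hβ₃ : β₃ = Real.arcsin (det2 vhat₃ (deriv γ s₄)))
    (hξ₂ : ξ₂ = Real.arcsin (-(c₂ * q3 P₁ P₂ P₃)))
    (hη₃ : η₃ = Real.arcsin (c₃ * q3 P₃ P₄ P₅))
    (ρ₃ : ℝ) (hρmem : ρ₃ ∈ Set.Ioc (-Real.pi) Real.pi)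
    (hρcos : Real.cos ρ₃ = ⟪vhat₂, vhat₃⟫_ℝ)
    (hρsin : Real.sin ρ₃ = det2 vhat₂ vhat₃) :
    (ξ₂ ≤ α₂ ∧ α₂ ≤ -β₂ ∧ -β₂ ≤ η₃ - ρ₃) ∧
    (-η₃ ≤ -β₃ ∧ -β₃ ≤ α₃ ∧ α₃ ≤ -ξ₂ - ρ₃) := by
  have hne : ∀ {A B : EuclideanSpace ℝ (Fin 2)}, A ≠ B → B - A ≠ 0 := fun h =>
    sub_ne_zero.2 h.symm
  simp only [List.pairwise_cons, List.mem_cons, List.not_mem_nil, or_false, forall_eq_or_imp,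
    forall_eq] at hdist
  obtain ⟨⟨h12', h13', -⟩, ⟨h23', -⟩, ⟨h34', h35'⟩, h45', -⟩ := hdist
  have n₁ : v₁ ≠ 0 := hv₁ ▸ hne h12'
  have n₂ : v₂ ≠ 0 := hv₂ ▸ hne h23'
  have n₃ : v₃ ≠ 0 := hv₃ ▸ hne h34'
  have n₄ : v₄ ≠ 0 := hv₄ ▸ hne h45'
  have s12 : v₁ + v₂ = P₃ - P₁ := by rw [hv₁, hv₂]; abel
  have s34 : v₃ + v₄ = P₅ - P₃ := by rw [hv₃, hv₄]; abel
  have A₁ := graphArc_of_projectable hγ hunit h12 (by rw [hv₁, hP₁, hP₂]) n₁ rfl hproj₁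
  have A₂ := graphArc_of_projectable hγ hunit h23 (by rw [hv₂, hP₂, hP₃]) n₂ hvhat₂ hproj₂
  have A₃ := graphArc_of_projectable hγ hunit h34 (by rw [hv₃, hP₃, hP₄]) n₃ hvhat₃ hproj₃
  have A₄ := graphArc_of_projectable hγ hunit h45 (by rw [hv₄, hP₄, hP₅]) n₄ rfl hproj₄
  have K₁ := hanti.mono (Set.Icc_subset_Icc_right h23.le)
  have K₂ := hanti.mono (Set.Icc_subset_Icc_left h12.le)
  have K₃ := (hmono.mono (Set.Icc_subset_Icc_right h45.le)).neg
  have K₄ := (hmono.mono (Set.Icc_subset_Icc_left h34.le)).neg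
  have r₁ := A₁.right_sub_curvature_nonneg K₁
  have l₂ := A₂.left_add_curvature_nonneg K₂
  have r₃ := A₃.neg.right_sub_curvature_nonneg K₃
  have l₄ := A₄.neg.left_add_curvature_nonneg K₄
  have m₂ := A₂.left_add_right_nonpos K₂
  have m₃ := A₃.neg.left_add_right_nonpos K₃
  have p₁ := norm_pos_iff.2 n₁
  have p₂ := norm_pos_iff.2 n₂
  have p₃ := norm_pos_iff.2 n₃
  have p₄ := norm_pos_iff.2 n₄
  rw [← hP₁, ← hP₂, ← hv₁, inner_normalize_self n₁] at r₁
  rw [← hP₂, ← hP₃, ← hv₂, hvhat₂, inner_normalize_self n₂] at l₂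
  rw [← hP₃, ← hP₄, ← hv₃, hvhat₃, inner_normalize_self n₃] at r₃
  rw [← hP₄, ← hP₅, ← hv₄, inner_normalize_self n₄] at l₄
  beta_reduce at r₁ l₂ r₃ l₄ m₂ m₃
  have hleft : ξ₂ ≤ α₂ := by
    rw [hξ₂, hα₂]
    apply Real.monotone_arcsin
    have := neg_det2_div_le_sin (hunit s₂) (hproj₁ s₂ ⟨h12.le, le_rfl⟩)
      (hvhat₂ ▸ hproj₂ s₂ ⟨le_rfl, h23.le⟩) 1 (one_pow 2)
      (by
        have e1 := mul_nonneg r₁ p₂.le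
        have e2 := mul_nonneg l₂ p₁.le
        linarith)
      hturn₁ (s12 ▸ hne h13')
    have hq : c₂ * q3 P₁ P₂ P₃ = 1 * det2 v₁ v₂ / (‖v₁‖ * ‖v₁ + v₂‖) := by
      have := norm_pos_iff.2 (s12 ▸ hne h13' : v₁ + v₂ ≠ 0)
      rw [q3, ← s12, ← hv₁, ← hv₂, hc₂]
      field_simp
    rw [hq, hvhat₂]
    linarith
  have hright : β₃ ≤ η₃ := by
    rw [hη₃, hβ₃]
    apply Real.monotone_arcsin
    have := neg_det2_div_le_sin (hunit s₄) (hproj₄ s₄ ⟨le_rfl, h45.le⟩)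
      (hvhat₃ ▸ hproj₃ s₄ ⟨h34.le, le_rfl⟩) (-1) (by norm_num)
      (by
        have e1 := mul_nonneg r₃ p₄.le
        have e2 := mul_nonneg l₄ p₃.le
        linarith)
      (by rwa [real_inner_comm]) (by rw [add_comm]; exact s34 ▸ hne h35')
    have hq : c₃ * q3 P₃ P₄ P₅ = -1 * det2 v₄ v₃ / (‖v₄‖ * ‖v₄ + v₃‖) := by
      have := norm_pos_iff.2 (s34 ▸ hne h35' : v₃ + v₄ ≠ 0)
      have hsw : det2 v₃ v₄ = -det2 v₄ v₃ := by simp only [det2]; ring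
      rw [q3, ← s34, ← hv₃, ← hv₄, hc₃, hsw, add_comm v₄]
      field_simp
    rw [hq, hvhat₃]
    linarith
  have hmid₂ : α₂ ≤ -β₂ := by
    rw [hα₂, hβ₂, ← Real.arcsin_neg]
    exact Real.monotone_arcsin (by linarith)
  have hmid₃ : -β₃ ≤ α₃ := by
    rw [hα₃, hβ₃, ← Real.arcsin_neg]
    exact Real.monotone_arcsin (by linarith)
  have hnorm : ∀ v : EuclideanSpace ℝ (Fin 2), v ≠ 0 → ‖‖v‖⁻¹ • v‖ = 1 := fun v hv =>
    norm_smul_inv_norm hv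
  have hρ : ρ₃ = β₂ - α₃ := by
    rw [hβ₂, hα₃]
    exact angle_eq_arcsin_sub_arcsin (hunit s₃) (hvhat₂ ▸ hnorm v₂ n₂) (hvhat₃ ▸ hnorm v₃ n₃)
      (hproj₂ s₃ ⟨h23.le, le_rfl⟩) (hproj₃ s₃ ⟨le_rfl, h34.le⟩) hρmem hρcos hρsin
  refine ⟨⟨hleft, hmid₂, ?_⟩, ?_, hmid₃, ?_⟩ <;> linarith
end

section
/- Proposition 3, lens bound on a chord adjacent to a vertex: Let γ be a unit-speed plane curve with signed curvature k, let s₁ < s₂ < s₃ < s₄ < s₅, set Pᵢ = γ(sᵢ) (pairwise distinct) and vᵢ = P_{i+1} − Pᵢ with cᵢ = ‖vᵢ‖/2 and v̂ᵢ = vᵢ/‖vᵢ‖. Assume k is nonincreasing on [s₁, s₃] and nondecreasing on [s₃, s₅] (vertex of minimal curvature at P₃), each of the four arcs is one-to-one projectable onto its chord (⟨γ'(s), v̂ᵢ⟩ > 0 for s ∈ [s_i, s_{i+1}], i = 1,…,4), and ‖v₁‖² + ⟨v₁, v₂⟩ ≥ 0 and ‖v₄‖² + ⟨v₃, v₄⟩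 ≥ 0. Define ξ₂ = arcsin(−c₂·q(P₁, P₂, P₃)), η₃ = arcsin(c₃·q(P₃, P₄, P₅)), and let ρ₃ ∈ (−π, π] be the signed angle from v̂₂ to v̂₃; assume additionally |η₃ − ρ₃| ≤ π/2. Then for every s ∈ [s₂, s₃], writing M = (P₂ + P₃)/2, u = ⟨γ(s) − M, v̂₂⟩ and w = det(v̂₂, γ(s) − M), one has A(u; c₂, ξ₂) ≤ w ≤ A(u; c₂, η₃ − ρ₃). -/
open scoped InnerProductSpace

/-- The circular arc from `(−c, 0)` to `(c, 0)` whose tangent at `(−c, 0)`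
makes angle `φ` with the positive `x`-axis, as a function of `x`. -/
noncomputable def arcA (c φ x : ℝ) : ℝ :=
  ((c ^ 2 - x ^ 2) * Real.sin φ) /
    (c * Real.cos φ + Real.sqrt (c ^ 2 - x ^ 2 * Real.sin φ ^ 2))

/-- For unit vectors `(r, p)` and `(τ, σ)` in the right half plane, the sign of their cross
product is the sign of `σ - p`. -/
lemma cross_pos_of_lt {r p τ σ : ℝ} (hr : 0 ≤ r) (hτ : 0 < τ) (h₁ : r ^ 2 + p ^ 2 = 1)
    (h₂ : τ ^ 2 + σ ^ 2 = 1) (h : p < σ) : 0 < σ * r - τ * p := by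
  rcases le_or_gt 0 p with hp | hp
  · have hlt : τ < r := by
      by_contra! hle
      nlinarith
    nlinarith
  · rcases le_or_gt 0 σ with hσ | hσ
    · nlinarith [mul_nonneg hσ hr, mul_pos hτ (neg_pos.2 hp)]
    · have hlt : r < τ := by
        by_contra! hle
        nlinarith
      nlinarith

lemma cross_neg_of_lt {r p τ σ : ℝ} (hr : 0 ≤ r) (hτ : 0 < τ) (h₁ : r ^ 2 + p ^ 2 = 1)
    (h₂ : τ ^ 2 + σ ^ 2 = 1) (h : σ < p) : σ * r - τ * p < 0 := by
  have := cross_pos_of_lt hr hτ (p := -p) (σ := -σ) (by simpa using h₁) (by simpa using h₂)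
    (neg_lt_neg h)
  linarith

lemma cross_nonneg_of_le {r p τ σ : ℝ} (hr : 0 ≤ r) (hτ : 0 < τ) (h₁ : r ^ 2 + p ^ 2 = 1)
    (h₂ : τ ^ 2 + σ ^ 2 = 1) (h : p ≤ σ) : 0 ≤ σ * r - τ * p := by
  rcases h.lt_or_eq with h | rfl
  · exact (cross_pos_of_lt hr hτ h₁ h₂ h).le
  · have : r = τ := (sq_eq_sq₀ hr hτ.le).1 (by linarith)
    subst this
    linarith

/-- The coordinates `u`, `w` of a unit-speed curve on `[a, b]` relative to the frame of its chord
of length `2 * c`, centred at the midpoint of the chord; `(τ, σ)` is the unit tangent and `κ` the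
signed curvature. The arc is one-to-one projectable onto its chord. -/
structure ChordArc (a b c : ℝ) (u w τ σ κ : ℝ → ℝ) : Prop where
  lt : a < b
  c_pos : 0 < c
  deriv_u : ∀ s, HasDerivAt u (τ s) s
  deriv_w : ∀ s, HasDerivAt w (σ s) s
  deriv_σ : ∀ s, HasDerivAt σ (κ s * τ s) s
  unit : ∀ s, τ s ^ 2 + σ s ^ 2 = 1
  pos : ∀ s ∈ Set.Icc a b, 0 < τ s
  u_left : u a = -c
  u_right : u b = c
  w_left : w a = 0
  w_right : w b = 0

namespace ChordArc

variable {a b c : ℝ} {u w τ σ κ : ℝ → ℝ}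

lemma reflect (h : ChordArc a b c u w τ σ κ) :
    ChordArc a b c u (fun s => -w s) τ (fun s => -σ s) (fun s => -κ s) where
  lt := h.lt
  c_pos := h.c_pos
  deriv_u := h.deriv_u
  deriv_w s := (h.deriv_w s).neg
  deriv_σ s := by simpa [Function.comp_def, Pi.neg_def] using (h.deriv_σ s).neg
  unit s := by simpa using h.unit s
  pos := h.pos
  u_left := h.u_left
  u_right := h.u_right
  w_left := by simp [h.w_left]
  w_right := by simp [h.w_right]

lemma reverse (h : ChordArc a b c u w τ σ κ) :
    ChordArc (-b) (-a) c (fun s => -u (-s)) (fun s => -w (-s)) (fun s => τ (-s))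
      (fun s => σ (-s)) (fun s => -κ (-s)) where
  lt := neg_lt_neg h.lt
  c_pos := h.c_pos
  deriv_u s := by
    simpa [Function.comp_def, Pi.neg_def] using ((h.deriv_u (-s)).scomp s (hasDerivAt_neg s)).neg
  deriv_w s := by
    simpa [Function.comp_def, Pi.neg_def] using ((h.deriv_w (-s)).scomp s (hasDerivAt_neg s)).neg
  deriv_σ s := by
    simpa [Function.comp_def, Pi.neg_def] using (h.deriv_σ (-s)).scomp s (hasDerivAt_neg s)
  unit s := h.unit (-s)
  pos s hs := h.pos (-s) ⟨by linarith [hs.2], by linarith [hs.1]⟩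
  u_left := by simp [h.u_right]
  u_right := by simp [h.u_left]
  w_left := by simp [h.w_right]
  w_right := by simp [h.w_left]

lemma left_mem (h : ChordArc a b c u w τ σ κ) : a ∈ Set.Icc a b := ⟨le_rfl, h.lt.le⟩

lemma right_mem (h : ChordArc a b c u w τ σ κ) : b ∈ Set.Icc a b := ⟨h.lt.le, le_rfl⟩

lemma strictMonoOn_u (h : ChordArc a b c u w τ σ κ) : StrictMonoOn u (Set.Icc a b) := by
  refine strictMonoOn_of_deriv_pos (convex_Icc a b)
    (fun s _ => (h.deriv_u s).continuousAt.continuousWithinAt) fun s hs => ?_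
  rw [(h.deriv_u s).deriv]
  exact h.pos s (interior_subset hs)

lemma u_mem_Icc (h : ChordArc a b c u w τ σ κ) {s : ℝ} (hs : s ∈ Set.Icc a b) :
    u s ∈ Set.Icc (-c) c := by
  have h₁ := h.strictMonoOn_u.monotoneOn h.left_mem hs hs.1
  have h₂ := h.strictMonoOn_u.monotoneOn hs h.right_mem hs.2
  rw [h.u_left] at h₁
  rw [h.u_right] at h₂
  exact ⟨h₁, h₂⟩

lemma u_mem_Ioo (h : ChordArc a b c u w τ σ κ) {s : ℝ} (hs : s ∈ Set.Ioo a b) :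
    u s ∈ Set.Ioo (-c) c := by
  have hs' := Set.Ioo_subset_Icc_self hs
  have h₁ := h.strictMonoOn_u h.left_mem hs' hs.1
  have h₂ := h.strictMonoOn_u hs' h.right_mem hs.2
  rw [h.u_left] at h₁
  rw [h.u_right] at h₂
  exact ⟨h₁, h₂⟩

end ChordArc

/-- The height of the circular arc over `[-c, c]` whose initial tangent is `(r, p)`. -/
noncomputable def arcHeight (c r p x : ℝ) : ℝ :=
  (Real.sqrt (c ^ 2 - x ^ 2 * p ^ 2) - c * r) / p

lemma arcHeight_endpoint {c r p x : ℝ} (hc : 0 ≤ c) (hr : 0 ≤ r) (h : r ^ 2 + p ^ 2 = 1)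
    (hx : x ^ 2 = c ^ 2) : arcHeight c r p x = 0 := by
  have : c ^ 2 - x ^ 2 * p ^ 2 = (c * r) ^ 2 := by
    linear_combination -p ^ 2 * hx - c ^ 2 * h
  rw [arcHeight, this, Real.sqrt_sq (by positivity)]
  simp

lemma arcA_eq_arcHeight {c φ x : ℝ} (hc : 0 < c) (hφ : 0 ≤ Real.cos φ)
    (hx : x ∈ Set.Icc (-c) c) : arcA c φ x = arcHeight c (Real.cos φ) (Real.sin φ) x := by
  have hunit := Real.cos_sq_add_sin_sq φ
  have hxc : x ^ 2 ≤ c ^ 2 := sq_le_sq' hx.1 hx.2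
  rw [arcA, arcHeight]
  set p := Real.sin φ
  set r := Real.cos φ
  have hnn : 0 ≤ c ^ 2 - x ^ 2 * p ^ 2 := by nlinarith [sq_nonneg r, sq_nonneg x]
  have hS := Real.sq_sqrt hnn
  have hS0 := Real.sqrt_nonneg (c ^ 2 - x ^ 2 * p ^ 2)
  set S := Real.sqrt (c ^ 2 - x ^ 2 * p ^ 2)
  rcases eq_or_ne p 0 with hp | hp
  · simp [hp]
  have hcr : 0 ≤ c * r := by positivity
  rcases (add_nonneg hcr hS0).eq_or_lt with h0 | h0
  · have h1 : S = 0 := by linarith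
    have h2 : c * r = 0 := by linarith
    simp [h1, h2]
  · rw [div_eq_div_iff h0.ne' hp]
    linear_combination -hS + c ^ 2 * hunit

lemma arcA_neg_neg (c φ x : ℝ) : arcA c (-φ) (-x) = -arcA c φ x := by
  simp [arcA, neg_div]

/-- A function on `[a, b]` that starts nonnegative and whose derivative is a positive multiple of
an antitone function is nonnegative up to any given point or nonpositive from that point on. -/
lemma nonneg_before_or_nonpos_after {a b : ℝ} {E τ m : ℝ → ℝ}
    (hE : ∀ s, HasDerivAt E (m s * τ s) s) (hτ : ∀ s ∈ Set.Icc a b, 0 < τ s)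
    (hm : AntitoneOn m (Set.Icc a b)) (ha : 0 ≤ E a) {s : ℝ} (hs : s ∈ Set.Icc a b) :
    (∀ t ∈ Set.Icc a s, 0 ≤ E t) ∨ ∀ t ∈ Set.Icc s b, E t ≤ 0 := by
  by_contra! hcon
  obtain ⟨⟨t, ht, hEt⟩, t', ht', hEt'⟩ := hcon
  have hat : a < t := ht.1.lt_of_ne (by rintro rfl; linarith)
  have htt' : t < t' := (ht.2.trans ht'.1).lt_of_ne (by rintro rfl; linarith)
  have hcont : Continuous E := continuous_iff_continuousAt.2 fun x => (hE x).continuousAt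
  obtain ⟨x, hx, hx'⟩ := exists_hasDerivAt_eq_slope E _ hat hcont.continuousOn fun y _ => hE y
  obtain ⟨y, hy, hy'⟩ := exists_hasDerivAt_eq_slope E _ htt' hcont.continuousOn fun y _ => hE y
  have hxI : x ∈ Set.Icc a b := ⟨hx.1.le, by linarith [hx.2, ht.2, hs.2]⟩
  have hyI : y ∈ Set.Icc a b := ⟨by linarith [hy.1], by linarith [hy.2, ht'.2]⟩
  have h₁ : m x * τ x < 0 := by
    rw [hx']
    exact div_neg_of_neg_of_pos (by linarith) (by linarith)
  have h₂ : 0 < m y * τ y := by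
    rw [hy']
    exact div_pos (by linarith) (by linarith)
  have h₃ := neg_of_mul_neg_left h₁ (hτ x hxI).le
  have h₄ := pos_of_mul_pos_left h₂ (hτ y hyI).le
  linarith [hm hxI hyI (by linarith [hx.2, hy.1])]

namespace ChordArc

variable {a b c : ℝ} {u w τ σ κ : ℝ → ℝ} {r p : ℝ}

lemma arcHeight_left (h : ChordArc a b c u w τ σ κ) (hr : 0 ≤ r) (hrp : r ^ 2 + p ^ 2 = 1) :
    arcHeight c r p (u a) = 0 :=
  arcHeight_endpoint h.c_pos.le hr hrp (by rw [h.u_left, neg_sq])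

lemma arcHeight_right (h : ChordArc a b c u w τ σ κ) (hr : 0 ≤ r) (hrp : r ^ 2 + p ^ 2 = 1) :
    arcHeight c r p (u b) = 0 :=
  arcHeight_endpoint h.c_pos.le hr hrp (by rw [h.u_right])

/-- The height of the arc over a circular arc on the same chord moves in the direction given by
comparing the sines of the two tangent angles over the same point of the chord. -/
lemma exists_hasDerivAt_gap (h : ChordArc a b c u w τ σ κ) (hrp : r ^ 2 + p ^ 2 = 1) {s : ℝ}
    (hs : s ∈ Set.Ioo a b) :
    ∃ d, HasDerivAt (fun s => w s - arcHeight c r p (u s)) d s ∧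
      (0 ≤ σ s + p / c * u s → 0 ≤ d) ∧ (0 < σ s + p / c * u s → 0 < d) := by
  have hc := h.c_pos
  have hu := h.u_mem_Ioo hs
  have hτ := h.pos s (Set.Ioo_subset_Icc_self hs)
  have hunit := h.unit s
  have huc : u s ^ 2 < c ^ 2 := sq_lt_sq' hu.1 hu.2
  have hnn : 0 < c ^ 2 - u s ^ 2 * p ^ 2 := by nlinarith [sq_nonneg r, sq_nonneg (u s)]
  have hS := Real.sq_sqrt hnn.le
  have hS0 := Real.sqrt_pos.2 hnn
  have hder : HasDerivAt (fun s => w s - arcHeight c r p (u s))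
      (σ s - (-((2 : ℕ) * u s ^ (2 - 1) * τ s * p ^ 2) /
        (2 * Real.sqrt (c ^ 2 - u s ^ 2 * p ^ 2))) / p) s :=
    (h.deriv_w s).sub ((((((h.deriv_u s).pow 2).mul_const (p ^ 2)).const_sub (c ^ 2)).sqrt
      hnn.ne').sub_const (c * r) |>.div_const p)
  set S := Real.sqrt (c ^ 2 - u s ^ 2 * p ^ 2)
  have hd : σ s - (-((2 : ℕ) * u s ^ (2 - 1) * τ s * p ^ 2) / (2 * S)) / p =
      (σ s * (S / c) - τ s * (-(p / c * u s))) * (c / S) := by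
    rcases eq_or_ne p 0 with rfl | hp
    · simp
      field_simp
    · push_cast
      field_simp
  have hcirc : (S / c) ^ 2 + (-(p / c * u s)) ^ 2 = 1 := by
    field_simp
    linear_combination hS
  have hr' : 0 ≤ S / c := by positivity
  have hq : 0 < c / S := by positivity
  rw [hd] at hder
  refine ⟨_, hder, fun hE => ?_, fun hE => ?_⟩
  · exact mul_nonneg (cross_nonneg_of_le hr' hτ hcirc hunit (by linarith)) hq.le
  · exact mul_pos (cross_pos_of_lt hr' hτ hcirc hunit (by linarith)) hq

lemma continuous_gap (h : ChordArc a b c u w τ σ κ) :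
    Continuous fun s => w s - arcHeight c r p (u s) := by
  have hu : Continuous u := continuous_iff_continuousAt.2 fun x => (h.deriv_u x).continuousAt
  have hw : Continuous w := continuous_iff_continuousAt.2 fun x => (h.deriv_w x).continuousAt
  unfold arcHeight
  fun_prop

lemma monotoneOn_gap (h : ChordArc a b c u w τ σ κ) (hrp : r ^ 2 + p ^ 2 = 1) {x y : ℝ}
    (hx : a ≤ x) (hy : y ≤ b) (hE : ∀ s ∈ Set.Icc x y, 0 ≤ σ s + p / c * u s) :
    MonotoneOn (fun s => w s - arcHeight c r p (u s)) (Set.Icc x y) := by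
  have hd : ∀ s ∈ interior (Set.Icc x y), ∃ d,
      HasDerivAt (fun s => w s - arcHeight c r p (u s)) d s ∧ 0 ≤ d := by
    intro s hs
    rw [interior_Icc] at hs
    obtain ⟨d, hd, h₁, -⟩ := h.exists_hasDerivAt_gap hrp
      (⟨hx.trans_lt hs.1, hs.2.trans_le hy⟩ : s ∈ Set.Ioo a b)
    exact ⟨d, hd, h₁ (hE s (Set.Ioo_subset_Icc_self hs))⟩
  refine monotoneOn_of_deriv_nonneg (convex_Icc x y) h.continuous_gap.continuousOn
    (fun s hs => ?_) fun s hs => ?_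
  · obtain ⟨d, hd, -⟩ := hd s hs
    exact hd.differentiableAt.differentiableWithinAt
  · obtain ⟨d, hd, hd0⟩ := hd s hs
    rwa [hd.deriv]

lemma antitoneOn_gap (h : ChordArc a b c u w τ σ κ) (hrp : r ^ 2 + p ^ 2 = 1) {x y : ℝ}
    (hx : a ≤ x) (hy : y ≤ b) (hE : ∀ s ∈ Set.Icc x y, σ s + p / c * u s ≤ 0) :
    AntitoneOn (fun s => w s - arcHeight c r p (u s)) (Set.Icc x y) := by
  have := h.reflect.monotoneOn_gap (r := r) (p := -p) (by rwa [neg_sq]) hx hy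
    fun s hs => by
      rw [neg_div, neg_mul]
      linarith [hE s hs]
  intro s hs t ht hst
  have := this hs ht hst
  simp only [arcHeight, neg_sq, div_neg] at this ⊢
  linarith

/-- The tangent of an arc cannot stay to the left of that of a circular arc on the same chord. -/
lemma end_nonpos_of_nonneg (h : ChordArc a b c u w τ σ κ) (hr : 0 ≤ r)
    (hrp : r ^ 2 + p ^ 2 = 1) (hE : ∀ s ∈ Set.Icc a b, 0 ≤ σ s + p / c * u s) :
    σ b + p ≤ 0 := by
  by_contra! hb
  have hc := h.c_pos
  have hcont : ContinuousAt (fun s => σ s + p / c * u s) b :=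
    (h.deriv_σ b).continuousAt.add (continuousAt_const.mul (h.deriv_u b).continuousAt)
  have hb' : 0 < σ b + p / c * u b := by
    rw [h.u_right, div_mul_cancel₀ _ hc.ne']
    exact hb
  have hev : ∀ᶠ s in nhdsWithin b (Set.Iio b), 0 < σ s + p / c * u s :=
    (hcont.eventually (lt_mem_nhds hb')).filter_mono nhdsWithin_le_nhds
  obtain ⟨s, hs, hsI⟩ := (hev.and (Ioo_mem_nhdsLT h.lt)).exists
  obtain ⟨d, hd, -, hpos⟩ := h.exists_hasDerivAt_gap hrp hsI
  have hmono := h.monotoneOn_gap hrp le_rfl le_rfl hE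
  have hzero : ∀ t ∈ Set.Icc a b, w t - arcHeight c r p (u t) = 0 := by
    intro t ht
    have h₁ := hmono h.left_mem ht ht.1
    have h₂ := hmono ht h.right_mem ht.2
    simp only [h.arcHeight_left hr hrp, h.arcHeight_right hr hrp, h.w_left, h.w_right] at h₁ h₂
    linarith
  have hd0 : HasDerivAt (fun s => w s - arcHeight c r p (u s)) 0 s :=
    (hasDerivAt_const s (0 : ℝ)).congr_of_eventuallyEq
      (Filter.eventuallyEq_of_mem (Icc_mem_nhds hsI.1 hsI.2) hzero)
  linarith [hpos hs, hd.unique hd0]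

lemma deriv_sin_gap (h : ChordArc a b c u w τ σ κ) (p s : ℝ) :
    HasDerivAt (fun s => σ s + p / c * u s) ((κ s + p / c) * τ s) s := by
  rw [add_mul]
  exact (h.deriv_σ s).add ((h.deriv_u s).const_mul (p / c))

/-- The lens lower bound for an arc with nonincreasing curvature. -/
lemma arcA_le (h : ChordArc a b c u w τ σ κ) (hκ : AntitoneOn κ (Set.Icc a b)) {φ : ℝ}
    (hφ : 0 ≤ Real.cos φ) (hstart : Real.sin φ ≤ σ a) {s : ℝ} (hs : s ∈ Set.Icc a b) :
    arcA c φ (u s) ≤ w s := by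
  have hrp := Real.cos_sq_add_sin_sq φ
  rw [arcA_eq_arcHeight h.c_pos hφ (h.u_mem_Icc hs)]
  have ha : 0 ≤ σ a + Real.sin φ / c * u a := by
    have := h.c_pos.ne'
    rw [h.u_left, mul_neg, div_mul_cancel₀ _ this]
    linarith
  rcases nonneg_before_or_nonpos_after (h.deriv_sin_gap (Real.sin φ)) h.pos
    (fun x hx y hy hxy => add_le_add_left (hκ hx hy hxy) _) ha hs with hE | hE
  · have := h.monotoneOn_gap hrp le_rfl hs.2 hE ⟨le_rfl, hs.1⟩ ⟨hs.1, le_rfl⟩ hs.1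
    simp only [h.arcHeight_left hφ hrp, h.w_left] at this
    linarith
  · have := h.antitoneOn_gap hrp hs.1 le_rfl hE ⟨le_rfl, hs.2⟩ ⟨hs.2, le_rfl⟩ hs.2
    simp only [h.arcHeight_right hφ hrp, h.w_right] at this
    linarith

lemma reverse_antitoneOn (hκ : AntitoneOn κ (Set.Icc a b)) :
    AntitoneOn (fun s => -κ (-s)) (Set.Icc (-b) (-a)) := fun x hx y hy hxy =>
  neg_le_neg (hκ ⟨by linarith [hy.2], by linarith [hy.1]⟩
    ⟨by linarith [hx.2], by linarith [hx.1]⟩ (neg_le_neg hxy))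

/-- The lens upper bound for an arc with nonincreasing curvature. -/
lemma le_arcA (h : ChordArc a b c u w τ σ κ) (hκ : AntitoneOn κ (Set.Icc a b)) {φ : ℝ}
    (hφ : 0 ≤ Real.cos φ) (hend : -Real.sin φ ≤ σ b) {s : ℝ} (hs : s ∈ Set.Icc a b) :
    w s ≤ arcA c φ (u s) := by
  have := h.reverse.arcA_le (reverse_antitoneOn hκ) (φ := -φ) (by rwa [Real.cos_neg])
    (by simpa using hend) (s := -s) ⟨neg_le_neg hs.2, neg_le_neg hs.1⟩
  simpa [arcA_neg_neg] using this

/-- The circle tangent to the arc at its start and passing through its end is no more curved to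
the left than the arc at its start. -/
lemma neg_sin_start_le (h : ChordArc a b c u w τ σ κ) (hκ : AntitoneOn κ (Set.Icc a b)) :
    -σ a ≤ c * κ a := by
  by_contra! hcon
  have hc := h.c_pos
  have hneg : κ a + σ a / c < 0 := by
    have : (κ a + σ a / c) * c < 0 := by
      rw [add_mul, div_mul_cancel₀ _ hc.ne']
      linarith
    exact neg_of_mul_neg_left this hc.le
  have hanti : StrictAntiOn (fun s => σ s + σ a / c * u s) (Set.Icc a b) := by
    refine strictAntiOn_of_deriv_neg (convex_Icc a b)
      (fun s _ => (h.deriv_sin_gap (σ a) s).continuousAt.continuousWithinAt) fun s hs => ?_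
    have hs' := interior_subset hs
    rw [(h.deriv_sin_gap (σ a) s).deriv]
    exact mul_neg_of_neg_of_pos (by linarith [hκ h.left_mem hs' hs'.1]) (h.pos s hs')
  have h0 : σ a + σ a / c * u a = 0 := by
    rw [h.u_left, mul_neg, div_mul_cancel₀ _ hc.ne', add_neg_cancel]
  have hb := hanti h.left_mem h.right_mem h.lt
  simp only [h0, h.u_right, div_mul_cancel₀ _ hc.ne'] at hb
  have := h.reflect.end_nonpos_of_nonneg (r := τ a) (p := -σ a) (h.pos a h.left_mem).le
    (by rw [neg_sq]; exact h.unit a) fun s hs => by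
      have := hanti.antitoneOn h.left_mem hs hs.1
      simp only [h0] at this
      rw [neg_div, neg_mul]
      linarith
  linarith

lemma le_sin_end (h : ChordArc a b c u w τ σ κ) (hκ : AntitoneOn κ (Set.Icc a b)) :
    c * κ b ≤ σ b := by
  have := h.reverse.neg_sin_start_le (reverse_antitoneOn hκ)
  simp only [neg_neg] at this
  linarith

/-- Vogt's theorem for an arc with nonincreasing curvature, in terms of its end tangents. -/
lemma sin_start_add_sin_end_nonpos (h : ChordArc a b c u w τ σ κ)
    (hκ : AntitoneOn κ (Set.Icc a b)) : σ a + σ b ≤ 0 := by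
  by_contra! hcon
  have hc := h.c_pos
  have h0 : σ a + σ a / c * u a = 0 := by
    rw [h.u_left, mul_neg, div_mul_cancel₀ _ hc.ne', add_neg_cancel]
  have hE := (nonneg_before_or_nonpos_after (h.deriv_sin_gap (σ a)) h.pos
    (fun x hx y hy hxy => add_le_add_left (hκ hx hy hxy) _) h0.ge h.right_mem).resolve_right
    fun hE => by
      have := hE b ⟨le_rfl, le_rfl⟩
      rw [h.u_right, div_mul_cancel₀ _ hc.ne'] at this
      linarith
  have := h.end_nonpos_of_nonneg (h.pos a h.left_mem).le (h.unit a) hE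
  linarith

end ChordArc

lemma inner_eq_coords (x y : EuclideanSpace ℝ (Fin 2)) : ⟪x, y⟫_ℝ = x 0 * y 0 + x 1 * y 1 := by
  simp [PiLp.inner_apply, Fin.sum_univ_two, mul_comm]

lemma norm_sq_eq_coords (x : EuclideanSpace ℝ (Fin 2)) : ‖x‖ ^ 2 = x 0 ^ 2 + x 1 ^ 2 := by
  simp [EuclideanSpace.norm_sq_eq, Fin.sum_univ_two]

lemma norm_inv_smul_self {v : EuclideanSpace ℝ (Fin 2)} (hv : v ≠ 0) : ‖‖v‖⁻¹ • v‖ = 1 := by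
  rw [norm_smul, norm_inv, norm_norm, inv_mul_cancel₀ (norm_ne_zero_iff.2 hv)]

lemma HasDerivAt.det2_const {f : ℝ → EuclideanSpace ℝ (Fin 2)} {f' : EuclideanSpace ℝ (Fin 2)}
    {s : ℝ} (e : EuclideanSpace ℝ (Fin 2)) (hf : HasDerivAt f f' s) :
    HasDerivAt (fun s => det2 e (f s)) (det2 e f') s := by
  have hi (i : Fin 2) : HasDerivAt (fun s => f s i) (f' i) s :=
    (EuclideanSpace.proj (𝕜 := ℝ) i).hasFDerivAt.comp_hasDerivAt s hf
  exact ((hi 1).const_mul (e 0)).sub ((hi 0).const_mul (e 1))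

lemma HasDerivAt.inner_const {f : ℝ → EuclideanSpace ℝ (Fin 2)} {f' : EuclideanSpace ℝ (Fin 2)}
    {s : ℝ} (e : EuclideanSpace ℝ (Fin 2)) (hf : HasDerivAt f f' s) :
    HasDerivAt (fun s => ⟪f s, e⟫_ℝ) ⟪f', e⟫_ℝ s := by
  simpa using hf.inner ℝ (hasDerivAt_const s e)

/-- An arc of a unit-speed curve that is projectable onto its chord, in chord coordinates. -/
lemma chordArc_of_projectable {γ : ℝ → EuclideanSpace ℝ (Fin 2)} (hγ : ContDiff ℝ 2 γ)
    (hunit : ∀ s, ‖deriv γ s‖ = 1) {a b : ℝ} (hab : a < b)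
    {v e M : EuclideanSpace ℝ (Fin 2)} (hv : v = γ b - γ a) (hne : v ≠ 0)
    (he : e = ‖v‖⁻¹ • v) (hM : M = (2 : ℝ)⁻¹ • (γ a + γ b))
    (hproj : ∀ s ∈ Set.Icc a b, 0 < ⟪deriv γ s, e⟫_ℝ) :
    ChordArc a b (‖v‖ / 2) (fun s => ⟪γ s - M, e⟫_ℝ) (fun s => det2 e (γ s - M))
      (fun s => ⟪deriv γ s, e⟫_ℝ) (fun s => det2 e (deriv γ s)) (signedCurv γ) := by
  have hnv : 0 < ‖v‖ := norm_pos_iff.2 hne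
  have hd1 (s : ℝ) : HasDerivAt γ (deriv γ s) s :=
    ((hγ.differentiable (by norm_num)) s).hasDerivAt
  have hd2 (s : ℝ) : HasDerivAt (deriv γ) (deriv (deriv γ) s) s := by
    have : ContDiff ℝ 1 (deriv γ) := ContDiff.deriv' (by simpa [one_add_one_eq_two] using hγ)
    exact ((this.differentiable (by norm_num)) s).hasDerivAt
  have hT (s : ℝ) : (deriv γ s) 0 ^ 2 + (deriv γ s) 1 ^ 2 = 1 := by
    rw [← norm_sq_eq_coords, hunit, one_pow]
  have horth (s : ℝ) : ⟪deriv γ s, deriv (deriv γ) s⟫_ℝ = 0 := by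
    have h₁ := (hd2 s).inner ℝ (hd2 s)
    have h₂ : (fun s => ⟪deriv γ s, deriv γ s⟫_ℝ) = fun _ => (1 : ℝ) := by
      funext t
      rw [real_inner_self_eq_norm_sq, hunit, one_pow]
    rw [h₂] at h₁
    have h₃ := h₁.unique (hasDerivAt_const s (1 : ℝ))
    rw [real_inner_comm (deriv γ s) (deriv (deriv γ) s)] at h₃
    linarith
  have he1 : e 0 ^ 2 + e 1 ^ 2 = 1 := by
    rw [← norm_sq_eq_coords, he, norm_inv_smul_self hne, one_pow]
  have hve : ⟪v, e⟫_ℝ = ‖v‖ := by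
    rw [he, real_inner_smul_right, real_inner_self_eq_norm_sq]
    field_simp
  have hdet : det2 e v = 0 := by
    simp only [he, det2, PiLp.smul_apply, smul_eq_mul]
    ring
  have hMa : γ a - M = (-(2 : ℝ)⁻¹) • v := by rw [hM, hv]; module
  have hMb : γ b - M = (2 : ℝ)⁻¹ • v := by rw [hM, hv]; module
  have hdet_smul (t : ℝ) : det2 e (t • v) = 0 := by
    have : det2 e (t • v) = t * det2 e v := by
      simp only [det2, PiLp.smul_apply, smul_eq_mul]
      ring
    rw [this, hdet, mul_zero]
  refine ⟨hab, by positivity, fun s => ((hd1 s).sub_const M).inner_const e,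
    fun s => ((hd1 s).sub_const M).det2_const e, fun s => ?_, fun s => ?_, hproj, ?_, ?_, ?_, ?_⟩
  · convert (hd2 s).det2_const e using 1
    have h₁ := hT s
    have h₂ := horth s
    rw [inner_eq_coords] at h₂
    simp only [signedCurv, det2, inner_eq_coords]
    set x := (deriv γ s) 0
    set y := (deriv γ s) 1
    set x' := (deriv (deriv γ) s) 0
    set y' := (deriv (deriv γ) s) 1
    linear_combination (e 0 * y' - e 1 * x') * h₁ + (-(e 0 * y) + e 1 * x) * h₂
  · simp only [det2, inner_eq_coords]
    linear_combination (e 0 ^ 2 + e 1 ^ 2) * hT s + he1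
  · simp only [hMa, real_inner_smul_left, hve]
    ring
  · simp only [hMb, real_inner_smul_left, hve]
    ring
  · simp only [hMa, hdet_smul]
  · simp only [hMb, hdet_smul]

/-- The tangent at the common point of the chords `A`, `B` of the circle circumscribed about them,
in the frame of `B`, compared with a unit vector `T`. -/
lemma circle_tangent_frame {A B T : EuclideanSpace ℝ (Fin 2)} (hA : A ≠ 0) (hB : B ≠ 0)
    (hAB : A + B ≠ 0) (hT : ‖T‖ = 1) (hturn : 0 ≤ ‖A‖ ^ 2 + ⟪A, B⟫_ℝ) :
    ∃ r p : ℝ, p = -(det2 A B / (‖A‖ * ‖A + B‖)) ∧ 0 ≤ r ∧ r ^ 2 + p ^ 2 = 1 ∧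
      ⟪T, ‖B‖⁻¹ • B⟫_ℝ ^ 2 + det2 (‖B‖⁻¹ • B) T ^ 2 = 1 ∧
      det2 (‖B‖⁻¹ • B) T * r - ⟪T, ‖B‖⁻¹ • B⟫_ℝ * p =
        (det2 (‖A‖⁻¹ • A) T / ‖A‖ + det2 (‖B‖⁻¹ • B) T / ‖B‖) * (‖A‖ * ‖B‖ / ‖A + B‖) := by
  have hA' : 0 < ‖A‖ := norm_pos_iff.2 hA
  have hB' : 0 < ‖B‖ := norm_pos_iff.2 hB
  have hAB' : 0 < ‖A + B‖ := norm_pos_iff.2 hAB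
  have hAn := norm_sq_eq_coords A
  have hBn := norm_sq_eq_coords B
  have hABn := norm_sq_eq_coords (A + B)
  have hTn := norm_sq_eq_coords T
  rw [hT] at hTn
  simp only [PiLp.add_apply] at hABn
  refine ⟨(‖A‖ ^ 2 + ⟪A, B⟫_ℝ) / (‖A‖ * ‖A + B‖), _, rfl, by positivity, ?_, ?_, ?_⟩
  · field_simp
    simp only [inner_eq_coords, det2, hABn, hAn]
    ring
  · simp only [inner_eq_coords, det2, PiLp.smul_apply, smul_eq_mul]
    field_simp
    rw [hBn]
    linear_combination -(B 0 ^ 2 + B 1 ^ 2) * hTn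
  · simp only [inner_eq_coords, det2, PiLp.smul_apply, smul_eq_mul]
    field_simp
    rw [hAn, hBn]
    ring

lemma sq_le_one_of_circle {r p : ℝ} (h : r ^ 2 + p ^ 2 = 1) : -1 ≤ p ∧ p ≤ 1 :=
  abs_le.1 ((sq_le_one_iff_abs_le_one p).1 (by linarith [sq_nonneg r]))

/-- For nonincreasing curvature, the tangent at the middle one of three points lies to the left of
the tangent of the circle through them. -/
lemma sin_arcsin_le_of_antitoneOn {γ : ℝ → EuclideanSpace ℝ (Fin 2)} (hγ : ContDiff ℝ 2 γ)
    (hunit : ∀ s, ‖deriv γ s‖ = 1) {s₁ s₂ s₃ : ℝ} (h12 : s₁ < s₂) (h23 : s₂ < s₃)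
    (hk : AntitoneOn (signedCurv γ) (Set.Icc s₁ s₃)) {A B : EuclideanSpace ℝ (Fin 2)}
    (hA : A = γ s₂ - γ s₁) (hB : B = γ s₃ - γ s₂) (hA0 : A ≠ 0) (hB0 : B ≠ 0) (hAB : A + B ≠ 0)
    (hprojA : ∀ s ∈ Set.Icc s₁ s₂, 0 < ⟪deriv γ s, ‖A‖⁻¹ • A⟫_ℝ)
    (hprojB : ∀ s ∈ Set.Icc s₂ s₃, 0 < ⟪deriv γ s, ‖B‖⁻¹ • B⟫_ℝ)
    (hturn : 0 ≤ ‖A‖ ^ 2 + ⟪A, B⟫_ℝ) :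
    Real.sin (Real.arcsin (-(‖B‖ / 2 * q3 (γ s₁) (γ s₂) (γ s₃)))) ≤
      det2 (‖B‖⁻¹ • B) (deriv γ s₂) := by
  have hnA := norm_pos_iff.2 hA0
  have hnB := norm_pos_iff.2 hB0
  have arcOfA := chordArc_of_projectable hγ hunit h12 hA hA0 rfl rfl hprojA
  have arcOfB := chordArc_of_projectable hγ hunit h23 hB hB0 rfl rfl hprojB
  obtain ⟨r, p, hp, hr, hrp, hT, hcross⟩ := circle_tangent_frame hA0 hB0 hAB (hunit s₂) hturn
  have hq : -(‖B‖ / 2 * q3 (γ s₁) (γ s₂) (γ s₃)) = p := by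
    rw [hp, q3, ← hA, ← hB, show γ s₃ - γ s₁ = A + B by rw [hA, hB]; abel]
    field_simp
  have hmem := sq_le_one_of_circle hrp
  rw [hq, Real.sin_arcsin hmem.1 hmem.2]
  have h₁ := arcOfA.le_sin_end (hk.mono (Set.Icc_subset_Icc_right h23.le))
  have h₂ := arcOfB.neg_sin_start_le (hk.mono (Set.Icc_subset_Icc_left h12.le))
  have h₃ : signedCurv γ s₂ / 2 ≤ det2 (‖A‖⁻¹ • A) (deriv γ s₂) / ‖A‖ := by
    rw [le_div_iff₀ hnA]
    linarith
  have h₄ : -(signedCurv γ s₂ / 2) ≤ det2 (‖B‖⁻¹ • B) (deriv γ s₂) / ‖B‖ := by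
    rw [le_div_iff₀ hnB]
    linarith
  by_contra! hlt
  have := cross_neg_of_lt hr (hprojB s₂ arcOfB.left_mem) hrp hT hlt
  rw [hcross] at this
  exact this.not_ge (mul_nonneg (by linarith) (by positivity))

/-- For nondecreasing curvature, the tangent at the middle one of three points lies to the right of
the tangent of the circle through them. -/
lemma le_sin_arcsin_of_monotoneOn {γ : ℝ → EuclideanSpace ℝ (Fin 2)} (hγ : ContDiff ℝ 2 γ)
    (hunit : ∀ s, ‖deriv γ s‖ = 1) {s₃ s₄ s₅ : ℝ} (h34 : s₃ < s₄) (h45 : s₄ < s₅)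
    (hk : MonotoneOn (signedCurv γ) (Set.Icc s₃ s₅)) {B A : EuclideanSpace ℝ (Fin 2)}
    (hB : B = γ s₄ - γ s₃) (hA : A = γ s₅ - γ s₄) (hA0 : A ≠ 0) (hB0 : B ≠ 0) (hAB : A + B ≠ 0)
    (hprojB : ∀ s ∈ Set.Icc s₃ s₄, 0 < ⟪deriv γ s, ‖B‖⁻¹ • B⟫_ℝ)
    (hprojA : ∀ s ∈ Set.Icc s₄ s₅, 0 < ⟪deriv γ s, ‖A‖⁻¹ • A⟫_ℝ)
    (hturn : 0 ≤ ‖A‖ ^ 2 + ⟪A, B⟫_ℝ) :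
    det2 (‖B‖⁻¹ • B) (deriv γ s₄) ≤
      Real.sin (Real.arcsin (‖B‖ / 2 * q3 (γ s₃) (γ s₄) (γ s₅))) := by
  have hnA := norm_pos_iff.2 hA0
  have hnB := norm_pos_iff.2 hB0
  have arcOfA := chordArc_of_projectable hγ hunit h45 hA hA0 rfl rfl hprojA
  have arcOfB := chordArc_of_projectable hγ hunit h34 hB hB0 rfl rfl hprojB
  obtain ⟨r, p, hp, hr, hrp, hT, hcross⟩ := circle_tangent_frame hA0 hB0 hAB (hunit s₄) hturn
  have hq : ‖B‖ / 2 * q3 (γ s₃) (γ s₄) (γ s₅) = p := by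
    rw [hp, q3, ← hA, ← hB, show γ s₅ - γ s₃ = A + B by rw [hA, hB]; abel,
      show det2 B A = -det2 A B by simp only [det2]; ring]
    field_simp
  have hmem := sq_le_one_of_circle hrp
  rw [hq, Real.sin_arcsin hmem.1 hmem.2]
  have h₁ := arcOfB.reflect.le_sin_end (hk.mono (Set.Icc_subset_Icc_right h45.le)).neg
  have h₂ := arcOfA.reflect.neg_sin_start_le (hk.mono (Set.Icc_subset_Icc_left h34.le)).neg
  have h₃ : det2 (‖A‖⁻¹ • A) (deriv γ s₄) / ‖A‖ ≤ -(signedCurv γ s₄ / 2) := by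
    rw [div_le_iff₀ hnA]
    linarith
  have h₄ : det2 (‖B‖⁻¹ • B) (deriv γ s₄) / ‖B‖ ≤ signedCurv γ s₄ / 2 := by
    rw [div_le_iff₀ hnB]
    linarith
  by_contra! hlt
  have := cross_pos_of_lt hr (hprojB s₄ arcOfB.right_mem) hrp hT hlt
  rw [hcross] at this
  exact this.not_ge (mul_nonpos_of_nonpos_of_nonneg (by linarith) (by positivity))

/-- Transfer of a lower bound on the tangent angle at a vertex from one chord to another. -/
lemma neg_sin_sub_le_det2 {e f T : EuclideanSpace ℝ (Fin 2)} (hf : ‖f‖ = 1) (hT : ‖T‖ = 1)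
    (heT : 0 < ⟪T, e⟫_ℝ) (hfT : 0 < ⟪T, f⟫_ℝ) {η ρ : ℝ}
    (hη : η ∈ Set.Icc (-(Real.pi / 2)) (Real.pi / 2)) (hρ : ρ ≤ Real.pi)
    (hρcos : Real.cos ρ = ⟪e, f⟫_ℝ) (hρsin : Real.sin ρ = det2 e f)
    (hrange : |η - ρ| ≤ Real.pi / 2) (h : -Real.sin η ≤ det2 f T) :
    -Real.sin (η - ρ) ≤ det2 e T := by
  have hf' := norm_sq_eq_coords f
  have hT' := norm_sq_eq_coords T
  rw [hf, one_pow] at hf'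
  rw [hT, one_pow] at hT'
  have hunit : ⟪T, f⟫_ℝ ^ 2 + det2 f T ^ 2 = 1 := by
    simp only [det2, inner_eq_coords]
    linear_combination -(T 0 ^ 2 + T 1 ^ 2) * hf' - hT'
  have hσ := sq_le_one_of_circle hunit
  set α := Real.arcsin (det2 f T) with hα
  have hsinα : Real.sin α = det2 f T := Real.sin_arcsin hσ.1 hσ.2
  have hcosα : Real.cos α = ⟪T, f⟫_ℝ := by
    rw [hα, Real.cos_arcsin, ← hunit, add_sub_cancel_right, Real.sqrt_sq hfT.le]
  have hsin : Real.sin (ρ + α) = det2 e T := by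
    rw [Real.sin_add, hsinα, hcosα, hρsin, hρcos]
    simp only [det2, inner_eq_coords]
    linear_combination -(e 0 * T 1 - e 1 * T 0) * hf'
  have hcos : Real.cos (ρ + α) = ⟪T, e⟫_ℝ := by
    rw [Real.cos_add, hsinα, hcosα, hρsin, hρcos]
    simp only [det2, inner_eq_coords]
    linear_combination -(e 0 * T 0 + e 1 * T 1) * hf'
  have hαlow : -η ≤ α := by
    rw [hα, Real.le_arcsin_iff_sin_le ⟨by linarith [hη.2], by linarith [hη.1]⟩ hσ, Real.sin_neg]
    exact h
  have hαup : α ≤ Real.pi / 2 := Real.arcsin_le_pi_div_two _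
  obtain ⟨hlow, hup⟩ := abs_le.1 hrange
  have hlt : ρ + α < Real.pi / 2 := by
    by_contra! hge
    have := Real.cos_nonpos_of_pi_div_two_le_of_le hge (by linarith)
    linarith
  rw [← Real.sin_neg, ← hsin]
  exact Real.sin_le_sin_of_le_of_le_pi_div_two (by linarith) hlt.le (by linarith)

/-- Proposition 3, lens bound on the chord `P₂P₃` ending at a vertex of
minimal curvature `P₃`: the curve segment lies between the circular arcs
with tangent angles `ξ₂` and `η₃ − ρ₃`. -/
theorem prop3_lens_bound_at_vertex
    (γ : ℝ → EuclideanSpace ℝ (Fin 2)) (hγ : ContDiff ℝ 2 γ)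
    (hunit : ∀ s, ‖deriv γ s‖ = 1)
    (s₁ s₂ s₃ s₄ s₅ : ℝ) (h12 : s₁ < s₂) (h23 : s₂ < s₃) (h34 : s₃ < s₄) (h45 : s₄ < s₅)
    (hanti : AntitoneOn (signedCurv γ) (Set.Icc s₁ s₃))
    (hmono : MonotoneOn (signedCurv γ) (Set.Icc s₃ s₅))
    (P₁ P₂ P₃ P₄ P₅ : EuclideanSpace ℝ (Fin 2))
    (hP₁ : P₁ = γ s₁) (hP₂ : P₂ = γ s₂) (hP₃ : P₃ = γ s₃) (hP₄ : P₄ = γ s₄)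
    (hP₅ : P₅ = γ s₅)
    (hdist : ([P₁, P₂, P₃, P₄, P₅] : List (EuclideanSpace ℝ (Fin 2))).Pairwise (· ≠ ·))
    (v₁ v₂ v₃ v₄ : EuclideanSpace ℝ (Fin 2))
    (hv₁ : v₁ = P₂ - P₁) (hv₂ : v₂ = P₃ - P₂) (hv₃ : v₃ = P₄ - P₃) (hv₄ : v₄ = P₅ - P₄)
    (c₂ c₃ : ℝ) (hc₂ : c₂ = ‖v₂‖ / 2) (hc₃ : c₃ = ‖v₃‖ / 2)
    (vhat₂ vhat₃ : EuclideanSpace ℝ (Fin 2))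
    (hvhat₂ : vhat₂ = ‖v₂‖⁻¹ • v₂) (hvhat₃ : vhat₃ = ‖v₃‖⁻¹ • v₃)
    (hproj₁ : ∀ s ∈ Set.Icc s₁ s₂, 0 < ⟪deriv γ s, ‖v₁‖⁻¹ • v₁⟫_ℝ)
    (hproj₂ : ∀ s ∈ Set.Icc s₂ s₃, 0 < ⟪deriv γ s, vhat₂⟫_ℝ)
    (hproj₃ : ∀ s ∈ Set.Icc s₃ s₄, 0 < ⟪deriv γ s, vhat₃⟫_ℝ)
    (hproj₄ : ∀ s ∈ Set.Icc s₄ s₅, 0 < ⟪deriv γ s, ‖v₄‖⁻¹ • v₄⟫_ℝ)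
    (hturn₁ : 0 ≤ ‖v₁‖ ^ 2 + ⟪v₁, v₂⟫_ℝ)
    (hturn₂ : 0 ≤ ‖v₄‖ ^ 2 + ⟪v₃, v₄⟫_ℝ)
    (ξ₂ η₃ : ℝ)
    (hξ₂ : ξ₂ = Real.arcsin (-(c₂ * q3 P₁ P₂ P₃)))
    (hη₃ : η₃ = Real.arcsin (c₃ * q3 P₃ P₄ P₅))
    (ρ₃ : ℝ) (hρmem : ρ₃ ∈ Set.Ioc (-Real.pi) Real.pi)
    (hρcos : Real.cos ρ₃ = ⟪vhat₂, vhat₃⟫_ℝ)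
    (hρsin : Real.sin ρ₃ = det2 vhat₂ vhat₃)
    (hrange : |η₃ - ρ₃| ≤ Real.pi / 2)
    (M : EuclideanSpace ℝ (Fin 2)) (hM : M = (2 : ℝ)⁻¹ • (P₂ + P₃)) :
    ∀ s ∈ Set.Icc s₂ s₃,
      arcA c₂ ξ₂ ⟪γ s - M, vhat₂⟫_ℝ ≤ det2 vhat₂ (γ s - M) ∧
      det2 vhat₂ (γ s - M) ≤ arcA c₂ (η₃ - ρ₃) ⟪γ s - M, vhat₂⟫_ℝ := by
  subst hP₁ hP₂ hP₃ hP₄ hP₅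
  have hne : γ s₁ ≠ γ s₂ ∧ γ s₁ ≠ γ s₃ ∧ γ s₂ ≠ γ s₃ ∧ γ s₃ ≠ γ s₄ ∧ γ s₃ ≠ γ s₅ ∧
      γ s₄ ≠ γ s₅ := by
    simp only [List.pairwise_cons, List.mem_cons, List.not_mem_nil, or_false] at hdist
    exact ⟨hdist.1 _ (by simp), hdist.1 _ (by simp), hdist.2.1 _ (by simp),
      hdist.2.2.1 _ (by simp), hdist.2.2.1 _ (by simp), hdist.2.2.2.1 _ (by simp)⟩
  obtain ⟨hne12, hne13, hne23, hne34, hne35, hne45⟩ := hne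
  have hv₁0 : v₁ ≠ 0 := hv₁ ▸ sub_ne_zero.2 hne12.symm
  have hv₂0 : v₂ ≠ 0 := hv₂ ▸ sub_ne_zero.2 hne23.symm
  have hv₃0 : v₃ ≠ 0 := hv₃ ▸ sub_ne_zero.2 hne34.symm
  have hv₄0 : v₄ ≠ 0 := hv₄ ▸ sub_ne_zero.2 hne45.symm
  have hv₁₂0 : v₁ + v₂ ≠ 0 := by
    rw [hv₁, hv₂, add_comm, sub_add_sub_cancel]
    exact sub_ne_zero.2 hne13.symm
  have hv₄₃0 : v₄ + v₃ ≠ 0 := by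
    rw [hv₄, hv₃, sub_add_sub_cancel]
    exact sub_ne_zero.2 hne35.symm
  have arc₂ := chordArc_of_projectable hγ hunit h23 hv₂ hv₂0 hvhat₂ hM hproj₂
  have arc₃ := chordArc_of_projectable hγ hunit h34 hv₃ hv₃0 hvhat₃ rfl hproj₃
  rw [← hc₂] at arc₂
  have hk₂ : AntitoneOn (signedCurv γ) (Set.Icc s₂ s₃) :=
    hanti.mono (Set.Icc_subset_Icc_left h12.le)
  have hstart := sin_arcsin_le_of_antitoneOn hγ hunit h12 h23 hanti hv₁ hv₂ hv₁0 hv₂0 hv₁₂0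
    hproj₁ (hvhat₂ ▸ hproj₂) hturn₁
  rw [← hc₂, ← hξ₂, ← hvhat₂] at hstart
  have hη := le_sin_arcsin_of_monotoneOn hγ hunit h34 h45 hmono hv₃ hv₄ hv₄0 hv₃0 hv₄₃0
    (hvhat₃ ▸ hproj₃) hproj₄ (by rwa [real_inner_comm])
  rw [← hc₃, ← hη₃, ← hvhat₃] at hη
  have hvogt := arc₃.reflect.sin_start_add_sin_end_nonpos
    (hmono.mono (Set.Icc_subset_Icc_right h45.le)).neg
  have hend := neg_sin_sub_le_det2 (hvhat₃ ▸ norm_inv_smul_self hv₃0) (hunit s₃)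
    (hproj₂ s₃ arc₂.right_mem) (hproj₃ s₃ arc₃.left_mem) (hη₃ ▸ Real.arcsin_mem_Icc _) hρmem.2
    hρcos hρsin hrange (by linarith)
  intro s hs
  exact ⟨arc₂.arcA_le hk₂ (hξ₂ ▸ Real.cos_arcsin_nonneg _) hstart hs,
    arc₂.le_arcA hk₂ (Real.cos_nonneg_of_mem_Icc (abs_le.1 hrange)) hend hs⟩
end
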